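/- Let p be a prime, let K be a field of characteristic p, and let a, b, c, d, e ∈ K with b ≠ 0 and d + a·b ≠ 0. Define a'' = (c − a·b)·b/(d + a·b) and b'' = (c + d)·b/(d + a·b) + a − b + e + d/b. Then I_p(a'', b'', c, d + 1, e) = I_p(a, b, c, d, e). (The polynomial I_p is invariant under the translation T₂ of the difference second Painlevé equation dP₂.) -/

import Mathlib

open MvPolynomial

noncomputable section

/-- The polynomial ring `R = 𝔽_p[f, g, α₁, α₂, t]`, with the five indeterminates
indexed by `0, 1, 2, 3, 4` respectively. -/
abbrev R (p : ℕ) := MvPolynomial (Fin 5) (ZMod p)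

def fP (p : ℕ) : R p := X 0
def gP (p : ℕ) : R p := X 1
def a1P (p : ℕ) : R p := X 2
def a2P (p : ℕ) : R p := X 3
def tP (p : ℕ) : R p := X 4

/-- `h = f·g·(t·g − 1)·(t·f − 1) + α₁·(t·g − 1) − α₂·(t·f − 1)`. -/
def hP (p : ℕ) : R p :=
  fP p * gP p * (tP p * gP p - 1) * (tP p * fP p - 1)
    + a1P p * (tP p * gP p - 1) - a2P p * (tP p * fP p - 1)

def A0 (p : ℕ) : Matrix (Fin 2) (Fin 2) (R p) :=
  !![-(a1P p) * gP p + fP p * gP p ^ 2 - tP p * fP p ^ 2 * gP p ^ 2, -(fP p * gP p);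
     fP p * gP p * hP p - a1P p * a2P p, -(a2P p) * fP p - fP p ^ 2 * gP p + tP p * fP p ^ 2 * gP p ^ 2]

def A1 (p : ℕ) : Matrix (Fin 2) (Fin 2) (R p) := !![0, 1; hP p, 0]

def A2 (p : ℕ) : Matrix (Fin 2) (Fin 2) (R p) :=
  !![tP p, 0; 1 - tP p ^ 2 * fP p * gP p, -(tP p)]

def A3 (p : ℕ) : Matrix (Fin 2) (Fin 2) (R p) := !![0, 0; -(tP p ^ 2), 0]

/-- The Lax coefficient matrix `A(z) = A₀ + z·A₁ + z²·A₂ + z³·A₃`, with entries in any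
commutative ring `S` receiving a ring homomorphism from `R`. -/
def AM (p : ℕ) {S : Type*} [CommRing S] (φ : R p →+* S) (z : S) : Matrix (Fin 2) (Fin 2) S :=
  (A0 p).map φ + z • (A1 p).map φ + z ^ 2 • (A2 p).map φ + z ^ 3 • (A3 p).map φ

/-- The integral of motion `I_p = Tr[A(p−1)·A(p−2)·⋯·A(1)·A(0)] ∈ R`. -/
def Ip (p : ℕ) : R p :=
  Matrix.trace (((List.range p).reverse.map (fun k => AM p (RingHom.id (R p)) (k : R p))).prod)

/-- Evaluation of a polynomial `P ∈ R` at a point `(a,b,c,d,e) ∈ K⁵` of a field (or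
commutative ring) of characteristic `p`. -/
def evalP (p : ℕ) (P : R p) (K : Type*) [CommRing K] [CharP K p] (a b c d e : K) : K :=
  eval₂ (ZMod.castHom (dvd_refl p) K) ![a, b, c, d, e] P

end

open Matrix

/-- The entry `h` of the Lax matrix, at a point of a commutative ring. -/
def laxEntry {S : Type*} [CommRing S] (f g α₁ α₂ t : S) : S :=
  f * g * (t * g - 1) * (t * f - 1) + α₁ * (t * g - 1) - α₂ * (t * f - 1)

/-- The Lax matrix `A(z)` at a point of a commutative ring. -/
def laxMatrix {S : Type*} [CommRing S] (f g α₁ α₂ t z : S) : Matrix (Fin 2) (Fin 2) S :=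
  !![-α₁ * g + f * g ^ 2 - t * f ^ 2 * g ^ 2 + z ^ 2 * t, -(f * g) + z;
     f * g * laxEntry f g α₁ α₂ t - α₁ * α₂ + z * laxEntry f g α₁ α₂ t
       + z ^ 2 * (1 - t ^ 2 * f * g) - z ^ 3 * t ^ 2,
     -α₂ * f - f ^ 2 * g + t * f ^ 2 * g ^ 2 - z ^ 2 * t]

/-- The ordered product `A(n-1) ⋯ A(1) A(0)`. -/
def orderedProd {M : Type*} [Monoid M] (A : ℕ → M) (n : ℕ) : M :=
  ((List.range n).reverse.map A).prod

theorem orderedProd_succ {M : Type*} [Monoid M] (A : ℕ → M) (n : ℕ) :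
    orderedProd A (n + 1) = A n * orderedProd A n := by
  simp [orderedProd, List.range_succ]

theorem map_orderedProd {M N : Type*} [Monoid M] [Monoid N] (φ : M →* N) (A : ℕ → M) (n : ℕ) :
    φ (orderedProd A n) = orderedProd (fun k => φ (A k)) n := by
  simp [orderedProd, map_list_prod, Function.comp_def]

/-- A gauge transformation intertwines the ordered products. -/
theorem orderedProd_mul_gauge {M : Type*} [Monoid M] (A A' B : ℕ → M)
    (h : ∀ k, A' k * B k = B (k + 1) * A k) (n : ℕ) :
    orderedProd A' n * B 0 = B n * orderedProd A n := by
  induction n with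
  | zero => simp [orderedProd]
  | succ n ih => rw [orderedProd_succ, orderedProd_succ, mul_assoc, ih, ← mul_assoc, h, mul_assoc]

theorem trace_eq_of_intertwine {n S : Type*} [Fintype n] [DecidableEq n] [CommRing S] [IsDomain S]
    {M M' B : Matrix n n S} (hB : B.det ≠ 0) (h : M' * B = B * M) : M'.trace = M.trace := by
  apply mul_left_cancel₀ hB
  calc B.det * M'.trace = (M' * (B * B.adjugate)).trace := by
        rw [mul_adjugate, Matrix.mul_smul, mul_one, trace_smul, smul_eq_mul]
    _ = (B * M * B.adjugate).trace := by rw [← mul_assoc, h]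
    _ = (B.adjugate * B * M).trace := by rw [trace_mul_comm, mul_assoc]
    _ = B.det * M.trace := by
        rw [adjugate_mul, Matrix.smul_mul, one_mul, trace_smul, smul_eq_mul]

theorem laxMatrix_map {S T : Type*} [CommRing S] [CommRing T] (φ : S →+* T)
    (f g α₁ α₂ t z : S) :
    φ.mapMatrix (laxMatrix f g α₁ α₂ t z) =
      laxMatrix (φ f) (φ g) (φ α₁) (φ α₂) (φ t) (φ z) := by
  ext i j
  fin_cases i <;> fin_cases j <;> simp [laxMatrix, laxEntry]

theorem AM_id_eq_laxMatrix (p : ℕ) (z : R p) :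
    AM p (RingHom.id (R p)) z = laxMatrix (fP p) (gP p) (a1P p) (a2P p) (tP p) z := by
  ext i j
  fin_cases i <;> fin_cases j <;>
    simp [AM, A0, A1, A2, A3, laxMatrix, laxEntry, hP] <;> ring

theorem evalP_Ip (p : ℕ) (K : Type*) [CommRing K] [CharP K p] (a b c d e : K) :
    evalP p (Ip p) K a b c d e =
      (orderedProd (fun k => laxMatrix a b c d e (k : K)) p).trace := by
  let φ : R p →+* K := eval₂Hom (ZMod.castHom (dvd_refl p) K) ![a, b, c, d, e]
  have hφ : evalP p (Ip p) K a b c d e = φ (Ip p) := rfl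
  have hI : Ip p = (orderedProd (fun k => AM p (RingHom.id (R p)) (k : R p)) p).trace := by
    simp only [Ip, orderedProd, List.bind_eq_flatMap, List.pure_def, ← List.map_eq_flatMap,
      List.map_map, Function.comp_def]
  have hf : φ (fP p) = a := by simp [φ, fP]
  have hg : φ (gP p) = b := by simp [φ, gP]
  have h1 : φ (a1P p) = c := by simp [φ, a1P]
  have h2 : φ (a2P p) = d := by simp [φ, a2P]
  have ht : φ (tP p) = e := by simp [φ, tP]
  rw [hφ, hI, AddMonoidHom.map_trace φ]
  change (φ.mapMatrix.toMonoidHom _).trace = _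
  rw [map_orderedProd]
  congr 2
  funext k
  rw [AM_id_eq_laxMatrix]
  change φ.mapMatrix _ = _
  rw [laxMatrix_map, hf, hg, h1, h2, ht, map_natCast]

/-- The gauge matrix of the translation `T₂`, where `(u, v)` is the image of `(f, g)`. -/
def gaugeMatrix {S : Type*} [CommRing S] (f g α₁ α₂ t u v z : S) : Matrix (Fin 2) (Fin 2) S :=
  !![t * z + t * (f * g) + u, 1;
     -(t ^ 2) * z ^ 2 + (t ^ 2 + 1 - t ^ 2 * (f * g) - t ^ 2 * (u * v)) * z
       + (laxEntry f g α₁ α₂ t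
         + t * ((-α₁ * g + f * g ^ 2 - t * f ^ 2 * g ^ 2)
           - (-α₁ * v + u * v ^ 2 - t * u ^ 2 * v ^ 2))
         + u * v * (t ^ 2 + 1 - t ^ 2 * (f * g) - t ^ 2 * (u * v))),
     -t * z + u + t - t * (u * v)]

theorem laxMatrix_mul_gaugeMatrix {S : Type*} [CommRing S] (f g α₁ α₂ t u v z : S)
    (h₁ : α₁ = f * g + u * (v - u - t)) (h₂ : α₂ = (v - u - f - t) * g) :
    laxMatrix u v α₁ (α₂ + 1) t z * gaugeMatrix f g α₁ α₂ t u v z =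
      gaugeMatrix f g α₁ α₂ t u v (z + 1) * laxMatrix f g α₁ α₂ t z := by
  subst h₁ h₂
  ext i j
  fin_cases i <;> fin_cases j <;>
    simp [laxMatrix, laxEntry, gaugeMatrix, Matrix.mul_apply, Fin.sum_univ_two] <;> ring

theorem det_gaugeMatrix {S : Type*} [CommRing S] (f g α₁ α₂ t u v z : S) :
    (gaugeMatrix f g α₁ α₂ t u v z).det = (gaugeMatrix f g α₁ α₂ t u v 0).det - z := by
  simp only [gaugeMatrix, det_fin_two_of]
  ring

theorem gaugeMatrix_map {S T : Type*} [CommRing S] [CommRing T] (φ : S →+* T)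
    (f g α₁ α₂ t u v z : S) :
    φ.mapMatrix (gaugeMatrix f g α₁ α₂ t u v z) =
      gaugeMatrix (φ f) (φ g) (φ α₁) (φ α₂) (φ t) (φ u) (φ v) (φ z) := by
  ext i j
  fin_cases i <;> fin_cases j <;> simp [gaugeMatrix, laxEntry]

theorem det_gaugeMatrix_X_ne_zero {K : Type*} [Field K] (f g α₁ α₂ t u v : K) :
    (gaugeMatrix (Polynomial.C f) (Polynomial.C g) (Polynomial.C α₁) (Polynomial.C α₂)
      (Polynomial.C t) (Polynomial.C u) (Polynomial.C v) Polynomial.X).det ≠ 0 := by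
  intro h
  have hz (z : K) : (gaugeMatrix f g α₁ α₂ t u v z).det = 0 := by
    have := congrArg (Polynomial.evalRingHom z) h
    simpa [RingHom.map_det, gaugeMatrix_map, -RingHom.mapMatrix_apply] using this
  have h₁ := hz 1
  rw [det_gaugeMatrix, hz 0] at h₁
  simp at h₁

theorem trace_orderedProd_laxMatrix_invariant (p : ℕ) {K : Type*} [Field K] [CharP K p]
    (f g α₁ α₂ t u v : K)
    (h₁ : α₁ = f * g + u * (v - u - t)) (h₂ : α₂ = (v - u - f - t) * g) :
    (orderedProd (fun k => laxMatrix u v α₁ (α₂ + 1) t (k : K)) p).trace =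
      (orderedProd (fun k => laxMatrix f g α₁ α₂ t (k : K)) p).trace := by
  let C : K →+* Polynomial K := Polynomial.C
  let A (k : ℕ) := laxMatrix (C f) (C g) (C α₁) (C α₂) (C t) (Polynomial.X + (k : Polynomial K))
  let A' (k : ℕ) := laxMatrix (C u) (C v) (C α₁) (C α₂ + 1) (C t)
    (Polynomial.X + (k : Polynomial K))
  let B (k : ℕ) := gaugeMatrix (C f) (C g) (C α₁) (C α₂) (C t) (C u) (C v)
    (Polynomial.X + (k : Polynomial K))
  have hAB : ∀ k, A' k * B k = B (k + 1) * A k := fun k => by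
    simp only [A, A', B, Nat.cast_succ, ← add_assoc]
    apply laxMatrix_mul_gaugeMatrix
    · simp [h₁]
    · simp [h₂]
  have hp : B p = B 0 := by simp [B, CharP.cast_eq_zero]
  have hB : (B 0).det ≠ 0 := by
    simpa [B, C] using det_gaugeMatrix_X_ne_zero f g α₁ α₂ t u v
  have htr := trace_eq_of_intertwine hB (hp ▸ orderedProd_mul_gauge A A' B hAB p)
  let φ : Polynomial K →+* K := Polynomial.evalRingHom 0
  have hmap (D : ℕ → Matrix (Fin 2) (Fin 2) (Polynomial K)) :
      φ (orderedProd D p).trace = (orderedProd (fun k => φ.mapMatrix (D k)) p).trace := by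
    rw [AddMonoidHom.map_trace φ]
    exact congrArg _ (map_orderedProd φ.mapMatrix.toMonoidHom D p)
  have := congrArg φ htr
  simpa [hmap, A, A', laxMatrix_map, φ, C, -RingHom.mapMatrix_apply] using this

/-- The integral of motion `I_p` is invariant under the translation `T₂`
of the difference second Painlevé equation `dP₂`. -/
theorem Ip_invariant_T2 (p : ℕ) (hp : p.Prime) (K : Type*) [Field K] [CharP K p]
    (a b c d e : K) (hb : b ≠ 0) (hdab : d + a * b ≠ 0) :
    evalP p (Ip p) K
      ((c - a * b) * b / (d + a * b))
      ((c + d) * b / (d + a * b) + a - b + e + d / b)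
      c (d + 1) e
    = evalP p (Ip p) K a b c d e := by
  rw [evalP_Ip, evalP_Ip]
  apply trace_orderedProd_laxMatrix_invariant
  · field_simp
    ring
  · have hq : (c + d) * b / (d + a * b) - (c - a * b) * b / (d + a * b) = b := by
      rw [← sub_div, div_eq_iff hdab]
      ring
    linear_combination -b * hq - div_mul_cancel₀ d hb
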